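/- Let f ∈ C²([a,b]) ∩ C⁴([a,b]∖X_b) be periodic in the sense that f(a) = f(b), f'(a) = f'(b), and f''(a) = f''(b), with bounded fourth derivative away from the breakpoints. Then there exists a unique periodic cubic spline p ∈ 𝕊₃²(X_b) interpolating f at X_b, and it satisfies, for every l ∈ [a,b] and every j = 0, 1, 2, |p^{(j)}(l) − f^{(j)}(l)| ≤ c_j h^{4−j} · max_{ξ∈[a,b]∖X_b} |f^{(4)}(ξ)|, where c₀ = 1/16 and c₁ = c₂ = 1/2. -/

import Mathlib

open Polynomial

/-- `q : ℕ → Polynomial ℝ` (with `q i` relevant for `i < N`) is the family of cubic pieces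
of a periodic cubic spline in `𝕊₃²(X_b)`, over the breakpoints `l 0 < l 1 < ⋯ < l N`,
interpolating `f` at the breakpoints.  The pieces are cubic polynomials glued `C²` at the
interior breakpoints; the periodicity condition says the spline and its first two
derivatives agree at the two endpoints `a = l 0` and `b = l N`. -/
def IsPeriodicInterp (N : ℕ) (l : ℕ → ℝ) (f : ℝ → ℝ) (q : ℕ → Polynomial ℝ) : Prop :=
  (∀ i < N, (q i).degree ≤ 3) ∧
  (∀ i, i + 1 < N → (q i).eval (l (i + 1)) = (q (i + 1)).eval (l (i + 1))) ∧
  (∀ i, i + 1 < N →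
    ((q i).derivative).eval (l (i + 1)) = ((q (i + 1)).derivative).eval (l (i + 1))) ∧
  (∀ i, i + 1 < N →
    ((q i).derivative.derivative).eval (l (i + 1)) =
      ((q (i + 1)).derivative.derivative).eval (l (i + 1))) ∧
  (q 0).eval (l 0) = (q (N - 1)).eval (l N) ∧
  ((q 0).derivative).eval (l 0) = ((q (N - 1)).derivative).eval (l N) ∧
  ((q 0).derivative.derivative).eval (l 0) = ((q (N - 1)).derivative.derivative).eval (l N) ∧
  (∀ i < N, (q i).eval (l i) = f (l i)) ∧
  (q (N - 1)).eval (l N) = f (l N)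

lemma hasDerivAt_parabola (u v K x : ℝ) :
    HasDerivAt (fun x => K / 2 * ((x - u) * (v - x))) (K / 2 * (u + v - 2 * x)) x :=
  ((((hasDerivAt_id' x).sub_const u).mul ((hasDerivAt_id' x).const_sub v)).const_mul
    (K / 2)).congr_deriv (by ring)

open Set in
/-- A function whose second derivative is at least `-K` becomes convex after subtracting the
parabola `K / 2 * (x - u) * (v - x)`. -/
lemma convexOn_sub_parabola {u v K : ℝ} {φ φ' φ'' : ℝ → ℝ}
    (hc : ContinuousOn φ (Icc u v)) (h1 : ∀ x ∈ Ioo u v, HasDerivAt φ (φ' x) x)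
    (h2 : ∀ x ∈ Ioo u v, HasDerivAt φ' (φ'' x) x) (hK : ∀ x ∈ Ioo u v, -K ≤ φ'' x) :
    ConvexOn ℝ (Icc u v) (fun x => φ x - K / 2 * ((x - u) * (v - x))) := by
  refine convexOn_of_hasDerivWithinAt2_nonneg (convex_Icc u v)
    (f' := fun x => φ' x - K / 2 * (u + v - 2 * x)) (f'' := fun x => φ'' x + K) ?_ ?_ ?_ ?_
  · exact hc.sub (by fun_prop)
  · rw [interior_Icc]
    intro x hx
    exact ((h1 x hx).sub (hasDerivAt_parabola u v K x)).hasDerivWithinAt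
  · rw [interior_Icc]
    intro x hx
    exact (((h2 x hx).sub ((((hasDerivAt_id' x).const_mul 2).const_sub (u + v)).const_mul
      (K / 2))).congr_deriv (by ring)).hasDerivWithinAt
  · rw [interior_Icc]
    intro x hx
    linarith [hK x hx]

open Set in
/-- Pointwise error bound for a function vanishing at both endpoints, one-sided version. -/
lemma le_parabola_of_neg_le_deriv2 {u v K : ℝ} {φ φ' φ'' : ℝ → ℝ}
    (hc : ContinuousOn φ (Icc u v)) (h1 : ∀ x ∈ Ioo u v, HasDerivAt φ (φ' x) x)
    (h2 : ∀ x ∈ Ioo u v, HasDerivAt φ' (φ'' x) x) (hK : ∀ x ∈ Ioo u v, -K ≤ φ'' x)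
    (hu : φ u = 0) (hv : φ v = 0) {x : ℝ} (hx : x ∈ Icc u v) :
    φ x ≤ K / 2 * ((x - u) * (v - x)) := by
  have huv : u ≤ v := hx.1.trans hx.2
  have := (convexOn_sub_parabola hc h1 h2 hK).le_max_of_mem_Icc
    (left_mem_Icc.2 huv) (right_mem_Icc.2 huv) hx
  simp only [hu, hv, sub_self, zero_mul, mul_zero, max_self] at this
  linarith

open Set in
lemma abs_le_of_abs_deriv2_le {u v K : ℝ} {φ φ' φ'' : ℝ → ℝ}
    (hc : ContinuousOn φ (Icc u v)) (h1 : ∀ x ∈ Ioo u v, HasDerivAt φ (φ' x) x)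
    (h2 : ∀ x ∈ Ioo u v, HasDerivAt φ' (φ'' x) x) (hK : ∀ x ∈ Ioo u v, |φ'' x| ≤ K)
    (hK0 : 0 ≤ K) (hu : φ u = 0) (hv : φ v = 0) {x : ℝ} (hx : x ∈ Icc u v) :
    |φ x| ≤ K * (v - u) ^ 2 / 8 := by
  have hpar : K / 2 * ((x - u) * (v - x)) ≤ K * (v - u) ^ 2 / 8 := by
    nlinarith [mul_nonneg hK0 (sq_nonneg (2 * x - u - v))]
  have hup := le_parabola_of_neg_le_deriv2 hc h1 h2 (fun y hy => (abs_le.1 (hK y hy)).1) hu hv hx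
  have hlo := le_parabola_of_neg_le_deriv2 (φ := fun y => -φ y) hc.neg (fun y hy => (h1 y hy).neg)
    (fun y hy => (h2 y hy).neg) (fun y hy => neg_le_neg (abs_le.1 (hK y hy)).2)
    (by simp [hu]) (by simp [hv]) hx
  exact abs_le.2 ⟨by linarith, by linarith⟩

open Set in
lemma deriv_endpoints_of_neg_le_deriv2 {u v A : ℝ} (huv : u < v) {g g' g'' : ℝ → ℝ}
    (h1 : ∀ x ∈ Icc u v, HasDerivWithinAt g (g' x) (Icc u v) x)
    (h2 : ∀ x ∈ Ioo u v, HasDerivAt g' (g'' x) x) (hA : ∀ x ∈ Ioo u v, -A ≤ g'' x)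
    (hu : g u = 0) (hv : g v = 0) :
    g' u ≤ A * (v - u) / 2 ∧ -(A * (v - u) / 2) ≤ g' v := by
  have hconv := convexOn_sub_parabola (fun x hx => (h1 x hx).continuousWithinAt)
    (fun x hx => (h1 x (Ioo_subset_Icc_self hx)).hasDerivAt (Icc_mem_nhds hx.1 hx.2)) h2 hA
  have hd : ∀ x ∈ Icc u v, HasDerivWithinAt (fun x => g x - A / 2 * ((x - u) * (v - x)))
      (g' x - A / 2 * (u + v - 2 * x)) (Icc u v) x := by
    intro x hx
    exact (h1 x hx).sub (hasDerivAt_parabola u v A x).hasDerivWithinAt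
  have hum := left_mem_Icc.2 huv.le
  have hvm := right_mem_Icc.2 huv.le
  have hl := hconv.le_slope_of_hasDerivWithinAt hum hvm huv (hd u hum)
  have hr := hconv.slope_le_of_hasDerivWithinAt hum hvm huv (hd v hvm)
  simp only [slope_def_field, hu, hv, sub_self, zero_mul, mul_zero, zero_div] at hl hr
  constructor <;> linarith

open Set in
/-- A function vanishing at both ends of an interval of length `v - u`, with second derivative
bounded by `A`, has slope at most `A * (v - u) / 2` at the endpoints. -/
lemma abs_deriv_endpoints_le {u v A : ℝ} (huv : u < v) {g g' g'' : ℝ → ℝ}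
    (h1 : ∀ x ∈ Icc u v, HasDerivWithinAt g (g' x) (Icc u v) x)
    (h2 : ∀ x ∈ Ioo u v, HasDerivAt g' (g'' x) x) (hA : ∀ x ∈ Ioo u v, |g'' x| ≤ A)
    (hu : g u = 0) (hv : g v = 0) :
    |g' u| ≤ A * (v - u) / 2 ∧ |g' v| ≤ A * (v - u) / 2 := by
  obtain ⟨a1, a2⟩ := deriv_endpoints_of_neg_le_deriv2 huv h1 h2
    (fun y hy => (abs_le.1 (hA y hy)).1) hu hv
  obtain ⟨b1, b2⟩ := deriv_endpoints_of_neg_le_deriv2 (g := fun y => -g y) huv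
    (fun y hy => (h1 y hy).neg) (fun y hy => (h2 y hy).neg)
    (fun y hy => neg_le_neg (abs_le.1 (hA y hy)).2) (by simp [hu]) (by simp [hv])
  exact ⟨abs_le.2 ⟨by linarith, by linarith⟩, abs_le.2 ⟨by linarith, by linarith⟩⟩

open Set in
/-- A function with equal values at the endpoints and second derivative bounded by `A` has first
derivative bounded by `A * (v - u)`. -/
lemma abs_deriv_le_of_endpoints_eq {u v A : ℝ} (huv : u < v) {g g' g'' : ℝ → ℝ}
    (h1 : ∀ x ∈ Icc u v, HasDerivWithinAt g (g' x) (Icc u v) x)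
    (h2 : ∀ x ∈ Icc u v, HasDerivWithinAt g' (g'' x) (Icc u v) x)
    (hA : ∀ x ∈ Icc u v, |g'' x| ≤ A) (huv' : g u = g v) {x : ℝ} (hx : x ∈ Icc u v) :
    |g' x| ≤ A * (v - u) := by
  obtain ⟨c, hc, hc0⟩ := exists_hasDerivAt_eq_zero huv
    (fun x hx => (h1 x hx).continuousWithinAt) huv'
    (fun x hx => (h1 x (Ioo_subset_Icc_self hx)).hasDerivAt (Icc_mem_nhds hx.1 hx.2))
  have hcm := Ioo_subset_Icc_self hc
  have hmv := (convex_Icc u v).norm_image_sub_le_of_norm_hasDerivWithin_le h2 hA hcm hx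
  rw [hc0, sub_zero, Real.norm_eq_abs, Real.norm_eq_abs] at hmv
  refine hmv.trans (mul_le_mul_of_nonneg_left ?_ ((abs_nonneg _).trans (hA x hx)))
  rw [abs_le]
  constructor <;> linarith [hx.1, hx.2, hc.1, hc.2]

/-- The cubic taking the values `y`, `z` and the second derivatives `m`, `n` at `u`, `v`. -/
noncomputable def momentCubic (u v y z m n : ℝ) : ℝ[X] :=
  C y + C ((z - y) / (v - u) - (v - u) * (2 * m + n) / 6) * (X - C u) +
    C (m / 2) * (X - C u) ^ 2 + C ((n - m) / (6 * (v - u))) * (X - C u) ^ 3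

section momentCubic

variable {u v : ℝ} (y z m n : ℝ)

lemma degree_momentCubic_le : (momentCubic u v y z m n).degree ≤ 3 := by
  unfold momentCubic
  compute_degree

lemma eval_momentCubic_left : (momentCubic u v y z m n).eval u = y := by
  simp [momentCubic]

lemma eval_momentCubic_right (huv : u < v) : (momentCubic u v y z m n).eval v = z := by
  have : v - u ≠ 0 := (sub_pos.2 huv).ne'
  simp only [momentCubic, eval_add, eval_mul, eval_C, eval_sub, eval_X, eval_pow]
  field_simp
  ring

lemma eval_derivative_momentCubic_left :
    (momentCubic u v y z m n).derivative.eval u =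
      (z - y) / (v - u) - (v - u) * (2 * m + n) / 6 := by
  simp [momentCubic, derivative_pow]

lemma eval_derivative_momentCubic_right (huv : u < v) :
    (momentCubic u v y z m n).derivative.eval v =
      (z - y) / (v - u) + (v - u) * (m + 2 * n) / 6 := by
  have : v - u ≠ 0 := (sub_pos.2 huv).ne'
  simp [momentCubic, derivative_pow]
  field_simp
  ring

lemma eval_derivative2_momentCubic (huv : u < v) (x : ℝ) :
    (momentCubic u v y z m n).derivative.derivative.eval x =
      (m * (v - x) + n * (x - u)) / (v - u) := by
  have : v - u ≠ 0 := (sub_pos.2 huv).ne'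
  simp [momentCubic, derivative_pow]
  field_simp
  ring

lemma eval_derivative2_momentCubic_left (huv : u < v) :
    (momentCubic u v y z m n).derivative.derivative.eval u = m := by
  rw [eval_derivative2_momentCubic _ _ _ _ huv, sub_self, mul_zero, add_zero,
    mul_div_cancel_right₀ _ (sub_pos.2 huv).ne']

lemma eval_derivative2_momentCubic_right (huv : u < v) :
    (momentCubic u v y z m n).derivative.derivative.eval v = n := by
  rw [eval_derivative2_momentCubic _ _ _ _ huv, sub_self, mul_zero, zero_add,
    mul_div_cancel_right₀ _ (sub_pos.2 huv).ne']

end momentCubic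

/-- A cubic is determined by its values and second derivatives at two points. -/
lemma eq_zero_of_degree_le_three {p : ℝ[X]} (hp : p.degree ≤ 3) {u v : ℝ} (huv : u < v)
    (hu : p.eval u = 0) (hv : p.eval v = 0) (hu2 : p.derivative.derivative.eval u = 0)
    (hv2 : p.derivative.derivative.eval v = 0) : p = 0 := by
  have hn : p.natDegree < 4 := Nat.lt_succ_of_le (natDegree_le_of_degree_le hp)
  obtain ⟨a, b, c, d, rfl⟩ : ∃ a b c d : ℝ, p = C a + C b * X + C c * X ^ 2 + C d * X ^ 3 :=
    ⟨_, _, _, _, by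
      conv_lhs => rw [p.as_sum_range_C_mul_X_pow' hn]
      simp [Finset.sum_range_succ]
      rfl⟩
  have huv' : v - u ≠ 0 := (sub_pos.2 huv).ne'
  simp [derivative_pow] at hu hv hu2 hv2
  have hd : d = 0 := by
    refine (mul_eq_zero.1 (?_ : d * (v - u) = 0)).resolve_right huv'
    linarith
  subst hd
  have hc : c = 0 := by linarith
  subst hc
  have hb : b = 0 := by
    refine (mul_eq_zero.1 (?_ : b * (v - u) = 0)).resolve_right huv'
    linarith
  subst hb
  have ha : a = 0 := by linarith
  subst ha
  simp

lemma eq_momentCubic {p : ℝ[X]} (hp : p.degree ≤ 3) {u v : ℝ} (huv : u < v) :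
    p = momentCubic u v (p.eval u) (p.eval v) (p.derivative.derivative.eval u)
      (p.derivative.derivative.eval v) := by
  rw [← sub_eq_zero]
  refine eq_zero_of_degree_le_three
    ((degree_sub_le _ _).trans (max_le hp (degree_momentCubic_le _ _ _ _))) huv ?_ ?_ ?_ ?_
  · rw [eval_sub, eval_momentCubic_left, sub_self]
  · rw [eval_sub, eval_momentCubic_right _ _ _ _ huv, sub_self]
  · simp only [derivative_sub, eval_sub]
    rw [eval_derivative2_momentCubic_left _ _ _ _ huv, sub_self]
  · simp only [derivative_sub, eval_sub]
    rw [eval_derivative2_momentCubic_right _ _ _ _ huv, sub_self]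

/-- Stability of the cyclic tridiagonal moment system. -/
lemma abs_le_of_cyclic_system {N : ℕ} (hN : 0 < N) {H M : ℕ → ℝ} {R : ℝ}
    (hH : ∀ i < N, 0 < H i) (hM : M N = M 0)
    (hsys : ∀ i, i + 1 < N → |H i * (M i + 2 * M (i + 1)) + H (i + 1) * (2 * M (i + 1) + M (i + 2))|
      ≤ (H i + H (i + 1)) * R)
    (hsys0 : |H (N - 1) * (M (N - 1) + 2 * M 0) + H 0 * (2 * M 0 + M 1)| ≤ (H (N - 1) + H 0) * R) :
    ∀ i ≤ N, |M i| ≤ R := by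
  obtain ⟨j, hj, hmax⟩ := Finset.exists_max_image (Finset.range N) (fun i => |M i|)
    ⟨0, Finset.mem_range.2 hN⟩
  rw [Finset.mem_range] at hj
  have hmax' : ∀ i ≤ N, |M i| ≤ |M j| := by
    intro i hi
    rcases hi.lt_or_eq with hi | rfl
    · exact hmax i (Finset.mem_range.2 hi)
    · rw [hM]
      exact hmax 0 (Finset.mem_range.2 hN)
  have key : ∀ α β x y z : ℝ, 0 < α → 0 < β → |x| ≤ |y| → |z| ≤ |y| →
      |α * (x + 2 * y) + β * (2 * y + z)| ≤ (α + β) * R → |y| ≤ R := by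
    intro α β x y z hα hβ hx hz hb
    have hsplit : 2 * (α + β) * y = (α * (x + 2 * y) + β * (2 * y + z)) - α * x - β * z := by ring
    have h1 : 2 * (α + β) * |y| ≤ (α + β) * R + α * |x| + β * |z| := by
      calc 2 * (α + β) * |y| = |2 * (α + β) * y| := by
            rw [abs_mul, abs_of_pos (by positivity : 0 < 2 * (α + β))]
        _ ≤ |α * (x + 2 * y) + β * (2 * y + z)| + |α * x| + |β * z| := by
            rw [hsplit]
            exact (abs_sub _ _).trans (by gcongr; exact abs_sub _ _)
        _ ≤ _ := by
            rw [abs_mul α, abs_mul β z, abs_of_pos hα, abs_of_pos hβ]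
            gcongr
    have h2 := mul_le_mul_of_nonneg_left hx hα.le
    have h3 := mul_le_mul_of_nonneg_left hz hβ.le
    refine le_of_mul_le_mul_left (?_ : (α + β) * |y| ≤ (α + β) * R) (by positivity)
    linarith
  intro i hi
  refine (hmax' i hi).trans ?_
  rcases j with _ | k
  · exact key _ _ _ _ _ (hH (N - 1) (by omega)) (hH 0 hN) (hmax' _ (by omega))
      (hmax' 1 (by omega)) hsys0
  · exact key _ _ _ _ _ (hH k (by omega)) (hH (k + 1) hj) (hmax' k (by omega))
      (hmax' (k + 2) (by omega)) (hsys k hj)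

/-- Solvability of the cyclic tridiagonal moment system. -/
lemma exists_cyclic_system {N : ℕ} (hN : 0 < N) {H : ℕ → ℝ} (hH : ∀ i < N, 0 < H i)
    (r : ℕ → ℝ) : ∃ M : ℕ → ℝ, M N = M 0 ∧
      (∀ i, i + 1 < N →
        H i * (M i + 2 * M (i + 1)) + H (i + 1) * (2 * M (i + 1) + M (i + 2)) = r (i + 1)) ∧
      H (N - 1) * (M (N - 1) + 2 * M 0) + H 0 * (2 * M 0 + M 1) = r 0 := by
  let E : (Fin N → ℝ) → ℕ → ℝ := fun m k => m ⟨k % N, Nat.mod_lt _ hN⟩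
  let P : ℕ → ℕ := fun k => if k = 0 then N - 1 else k - 1
  let T : (Fin N → ℝ) →ₗ[ℝ] (Fin N → ℝ) :=
    { toFun := fun m i => H (P i) * (E m (P i) + 2 * E m i) + H i * (2 * E m i + E m (i + 1))
      map_add' := fun m n => by
        ext i
        simp only [E, Pi.add_apply]
        ring
      map_smul' := fun c m => by
        ext i
        simp only [E, Pi.smul_apply, smul_eq_mul, RingHom.id_apply]
        ring }
  have hEN : ∀ m, E m N = E m 0 := fun m => by simp [E]
  have hT : ∀ m i (hi : i < N), T m ⟨i, hi⟩ =
      H (P i) * (E m (P i) + 2 * E m i) + H i * (2 * E m i + E m (i + 1)) := fun m i hi => rfl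
  have hinj : Function.Injective T := by
    rw [← LinearMap.ker_eq_bot, LinearMap.ker_eq_bot']
    intro m hm
    have hzero := abs_le_of_cyclic_system (R := 0) hN hH (hEN m)
      (fun i hi => by
        have := hT m (i + 1) hi
        simp only [hm, P, Pi.zero_apply, Nat.add_one_ne_zero, if_false, Nat.add_sub_cancel] at this
        rw [← this]
        simp)
      (by
        have := hT m 0 hN
        simp only [hm, P, Pi.zero_apply, if_true, zero_add] at this
        rw [← this]
        simp)
    ext i
    have := abs_nonpos_iff.1 (hzero i i.2.le)
    simpa [E, Nat.mod_eq_of_lt i.2] using this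
  obtain ⟨m, hm⟩ := LinearMap.injective_iff_surjective.1 hinj (fun i => r i)
  refine ⟨E m, hEN m, fun i hi => ?_, ?_⟩
  · have := hT m (i + 1) hi
    simp only [hm, P, Nat.add_one_ne_zero, if_false, Nat.add_sub_cancel] at this
    exact this.symm
  · have := hT m 0 hN
    simp only [hm, P, if_true, zero_add] at this
    exact this.symm

open Set in
/-- Error of linear interpolation. -/
lemma abs_linear_interp_sub_le {u v K : ℝ} (huv : u < v) {φ φ' φ'' : ℝ → ℝ}
    (hc : ContinuousOn φ (Icc u v)) (h1 : ∀ x ∈ Ioo u v, HasDerivAt φ (φ' x) x)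
    (h2 : ∀ x ∈ Ioo u v, HasDerivAt φ' (φ'' x) x) (hK : ∀ x ∈ Ioo u v, |φ'' x| ≤ K)
    (hK0 : 0 ≤ K) {x : ℝ} (hx : x ∈ Icc u v) :
    |(φ u * (v - x) + φ v * (x - u)) / (v - u) - φ x| ≤ K * (v - u) ^ 2 / 8 := by
  have huv' : v - u ≠ 0 := (sub_pos.2 huv).ne'
  refine abs_le_of_abs_deriv2_le
    (φ := fun x => (φ u * (v - x) + φ v * (x - u)) / (v - u) - φ x)
    (φ' := fun x => (φ v - φ u) / (v - u) - φ' x) (φ'' := fun x => -φ'' x) ?_ ?_ ?_ ?_ hK0 ?_ ?_ hx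
  · exact ContinuousOn.sub (by fun_prop) hc
  · intro y hy
    exact (((((hasDerivAt_id' y).const_sub v).const_mul (φ u)).add
      (((hasDerivAt_id' y).sub_const u).const_mul (φ v))).div_const (v - u)).congr_deriv
        (by ring) |>.sub (h1 y hy)
  · intro y hy
    exact (h2 y hy).const_sub _
  · intro y hy
    simpa using hK y hy
  · field_simp
    ring
  · field_simp
    ring

open Set in
/-- The cubic with the values and second derivatives of `f` at the endpoints nearly matches the
first derivatives of `f` there. -/
lemma abs_derivative_momentCubic_sub_le {u v A : ℝ} (huv : u < v) {f f' f'' : ℝ → ℝ}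
    (h1 : ∀ x ∈ Icc u v, HasDerivWithinAt f (f' x) (Icc u v) x)
    (h2 : ∀ x ∈ Icc u v, HasDerivWithinAt f' (f'' x) (Icc u v) x)
    (hA : ∀ x ∈ Icc u v, |(f'' u * (v - x) + f'' v * (x - u)) / (v - u) - f'' x| ≤ A) :
    |(f v - f u) / (v - u) - (v - u) * (2 * f'' u + f'' v) / 6 - f' u| ≤ A * (v - u) / 2 ∧
    |(f v - f u) / (v - u) + (v - u) * (f'' u + 2 * f'' v) / 6 - f' v| ≤ A * (v - u) / 2 := by
  let p := momentCubic u v (f u) (f v) (f'' u) (f'' v)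
  have := abs_deriv_endpoints_le (A := A) huv
    (g := fun x => p.eval x - f x) (g' := fun x => p.derivative.eval x - f' x)
    (g'' := fun x => p.derivative.derivative.eval x - f'' x)
    (fun x hx => (p.hasDerivAt x).hasDerivWithinAt.sub (h1 x hx))
    (fun x hx => (p.derivative.hasDerivAt x).sub
      ((h2 x (Ioo_subset_Icc_self hx)).hasDerivAt (Icc_mem_nhds hx.1 hx.2)))
    (fun x hx => by
      rw [eval_derivative2_momentCubic _ _ _ _ huv]
      exact hA x (Ioo_subset_Icc_self hx))
    (by rw [eval_momentCubic_left, sub_self])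
    (by rw [eval_momentCubic_right _ _ _ _ huv, sub_self])
  rwa [eval_derivative_momentCubic_left, eval_derivative_momentCubic_right _ _ _ _ huv] at this

open Set in
/-- Error of a cubic that interpolates `f` at both endpoints, in terms of the error of its second
derivative. -/
lemma abs_momentCubic_sub_le {u v B m n : ℝ} (huv : u < v) {f f' f'' : ℝ → ℝ}
    (h1 : ∀ x ∈ Icc u v, HasDerivWithinAt f (f' x) (Icc u v) x)
    (h2 : ∀ x ∈ Icc u v, HasDerivWithinAt f' (f'' x) (Icc u v) x)
    (hB : ∀ x ∈ Icc u v, |(m * (v - x) + n * (x - u)) / (v - u) - f'' x| ≤ B)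
    {x : ℝ} (hx : x ∈ Icc u v) :
    |(momentCubic u v (f u) (f v) m n).eval x - f x| ≤ B * (v - u) ^ 2 / 8 ∧
    |(momentCubic u v (f u) (f v) m n).derivative.eval x - f' x| ≤ B * (v - u) := by
  set p := momentCubic u v (f u) (f v) m n with hp
  have hB' : ∀ x ∈ Icc u v, |p.derivative.derivative.eval x - f'' x| ≤ B := by
    intro x hx
    rw [hp, eval_derivative2_momentCubic _ _ _ _ huv]
    exact hB x hx
  have hu : p.eval u - f u = 0 := by rw [hp, eval_momentCubic_left, sub_self]
  have hv : p.eval v - f v = 0 := by rw [hp, eval_momentCubic_right _ _ _ _ huv, sub_self]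
  have d1 : ∀ x ∈ Icc u v, HasDerivWithinAt (fun x => p.eval x - f x)
      (p.derivative.eval x - f' x) (Icc u v) x :=
    fun x hx => (p.hasDerivAt x).hasDerivWithinAt.sub (h1 x hx)
  have d2 : ∀ x ∈ Icc u v, HasDerivWithinAt (fun x => p.derivative.eval x - f' x)
      (p.derivative.derivative.eval x - f'' x) (Icc u v) x :=
    fun x hx => (p.derivative.hasDerivAt x).hasDerivWithinAt.sub (h2 x hx)
  exact ⟨abs_le_of_abs_deriv2_le (fun x hx => (d1 x hx).continuousWithinAt)
      (fun x hx => (d1 x (Ioo_subset_Icc_self hx)).hasDerivAt (Icc_mem_nhds hx.1 hx.2))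
      (fun x hx => (d2 x (Ioo_subset_Icc_self hx)).hasDerivAt (Icc_mem_nhds hx.1 hx.2))
      (fun x hx => hB' x (Ioo_subset_Icc_self hx)) ((abs_nonneg _).trans (hB' x hx)) hu hv hx,
    abs_deriv_le_of_endpoints_eq huv d1 d2 hB' (hu.trans hv.symm) hx⟩

lemma abs_linear_interp_sub_le_of_endpoints {u v x m n y z w R A : ℝ} (huv : u < v)
    (hx : x ∈ Set.Icc u v) (hm : |m - y| ≤ R) (hn : |n - z| ≤ R)
    (hA : |(y * (v - x) + z * (x - u)) / (v - u) - w| ≤ A) :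
    |(m * (v - x) + n * (x - u)) / (v - u) - w| ≤ R + A := by
  have huv' : 0 < v - u := sub_pos.2 huv
  have hsplit : (m * (v - x) + n * (x - u)) / (v - u) - w =
      ((m - y) * (v - x) + (n - z) * (x - u)) / (v - u) +
        ((y * (v - x) + z * (x - u)) / (v - u) - w) := by
    field_simp
    ring
  rw [hsplit]
  refine (abs_add_le _ _).trans (add_le_add ?_ hA)
  rw [abs_div, abs_of_pos huv', div_le_iff₀ huv']
  refine (abs_add_le _ _).trans ?_
  rw [abs_mul, abs_mul, abs_of_nonneg (sub_nonneg.2 hx.1), abs_of_nonneg (sub_nonneg.2 hx.2)]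
  calc _ ≤ R * (v - x) + R * (x - u) := by
        gcongr
        · exact sub_nonneg.2 hx.2
        · exact sub_nonneg.2 hx.1
    _ = _ := by ring

/-- The pieces of a spline with prescribed moments `M` form a periodic interpolating spline when
the first derivatives match. -/
lemma isPeriodicInterp_momentCubic {N : ℕ} (hN : 0 < N) {l : ℕ → ℝ}
    (hl : ∀ i < N, l i < l (i + 1)) {f : ℝ → ℝ} (hper : f (l 0) = f (l N)) {M : ℕ → ℝ}
    (hM : M N = M 0)
    (hsys : ∀ i, i + 1 < N →
      (l (i + 1) - l i) * (M i + 2 * M (i + 1)) +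
        (l (i + 2) - l (i + 1)) * (2 * M (i + 1) + M (i + 2)) =
      6 * ((f (l (i + 2)) - f (l (i + 1))) / (l (i + 2) - l (i + 1)) -
        (f (l (i + 1)) - f (l i)) / (l (i + 1) - l i)))
    (hsys0 : (l N - l (N - 1)) * (M (N - 1) + 2 * M 0) + (l 1 - l 0) * (2 * M 0 + M 1) =
      6 * ((f (l 1) - f (l 0)) / (l 1 - l 0) -
        (f (l N) - f (l (N - 1))) / (l N - l (N - 1)))) :
    IsPeriodicInterp N l f
      (fun i => momentCubic (l i) (l (i + 1)) (f (l i)) (f (l (i + 1))) (M i) (M (i + 1))) := by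
  have hN1 : N - 1 + 1 = N := by omega
  have hlN := hl (N - 1) (by omega)
  rw [hN1] at hlN
  refine ⟨fun i _ => degree_momentCubic_le _ _ _ _, fun i hi => ?_, fun i hi => ?_, fun i hi => ?_,
    ?_, ?_, ?_, fun i hi => eval_momentCubic_left _ _ _ _, ?_⟩ <;> simp only [hN1]
  · rw [eval_momentCubic_left, eval_momentCubic_right _ _ _ _ (hl i (by omega))]
  · rw [eval_derivative_momentCubic_left,
      eval_derivative_momentCubic_right _ _ _ _ (hl i (by omega))]
    linarith [hsys i hi]
  · rw [eval_derivative2_momentCubic_left _ _ _ _ (hl (i + 1) hi),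
      eval_derivative2_momentCubic_right _ _ _ _ (hl i (by omega))]
  · rw [eval_momentCubic_left, eval_momentCubic_right _ _ _ _ hlN, hper]
  · rw [eval_derivative_momentCubic_left, eval_derivative_momentCubic_right _ _ _ _ hlN, hM]
    simp only [zero_add]
    linarith
  · rw [eval_derivative2_momentCubic_left _ _ _ _ (hl 0 hN),
      eval_derivative2_momentCubic_right _ _ _ _ hlN, hM]
  · rw [eval_momentCubic_right _ _ _ _ hlN]

/-- Every periodic interpolating spline is given by moments solving the cyclic system. -/
lemma IsPeriodicInterp.exists_moments {N : ℕ} (hN : 0 < N) {l : ℕ → ℝ}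
    (hl : ∀ i < N, l i < l (i + 1)) {f : ℝ → ℝ} {q : ℕ → ℝ[X]} (hq : IsPeriodicInterp N l f q) :
    ∃ M : ℕ → ℝ, M N = M 0 ∧
    (∀ i < N, q i =
      momentCubic (l i) (l (i + 1)) (f (l i)) (f (l (i + 1))) (M i) (M (i + 1))) ∧
    (∀ i, i + 1 < N →
      (l (i + 1) - l i) * (M i + 2 * M (i + 1)) +
        (l (i + 2) - l (i + 1)) * (2 * M (i + 1) + M (i + 2)) =
      6 * ((f (l (i + 2)) - f (l (i + 1))) / (l (i + 2) - l (i + 1)) -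
        (f (l (i + 1)) - f (l i)) / (l (i + 1) - l i))) ∧
    (l N - l (N - 1)) * (M (N - 1) + 2 * M 0) + (l 1 - l 0) * (2 * M 0 + M 1) =
      6 * ((f (l 1) - f (l 0)) / (l 1 - l 0) -
        (f (l N) - f (l (N - 1))) / (l N - l (N - 1))) := by
  obtain ⟨hdeg, hv, hd, hd2, -, hd0, hd20, hint, hintN⟩ := hq
  have hN1 : N - 1 + 1 = N := by omega
  let M : ℕ → ℝ := fun i => (q (i % N)).derivative.derivative.eval (l (i % N))
  have hMlt : ∀ i < N, M i = (q i).derivative.derivative.eval (l i) := fun i hi => by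
    simp only [M, Nat.mod_eq_of_lt hi]
  have hM : M N = M 0 := by simp [M]
  have hpiece : ∀ i < N, q i =
      momentCubic (l i) (l (i + 1)) (f (l i)) (f (l (i + 1))) (M i) (M (i + 1)) := by
    intro i hi
    have hright : (q i).eval (l (i + 1)) = f (l (i + 1)) ∧
        (q i).derivative.derivative.eval (l (i + 1)) = M (i + 1) := by
      rcases Nat.lt_or_ge (i + 1) N with hi' | hi'
      · rw [hv i hi', hint _ hi', hd2 i hi', hMlt _ hi']
        exact ⟨rfl, rfl⟩
      · obtain rfl : i = N - 1 := by omega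
        rw [hN1, hM, hMlt 0 hN]
        exact ⟨hintN, hd20.symm⟩
    rw [← hright.1, ← hright.2, ← hint i hi, hMlt i hi]
    exact eq_momentCubic (hdeg i hi) (hl i hi)
  refine ⟨M, hM, hpiece, fun i hi => ?_, ?_⟩
  · have := hd i hi
    rw [hpiece i (by omega), hpiece (i + 1) hi, eval_derivative_momentCubic_left,
      eval_derivative_momentCubic_right _ _ _ _ (hl i (by omega))] at this
    linarith
  · have hlN := hl (N - 1) (by omega)
    have := hd0
    rw [hpiece 0 hN, hpiece (N - 1) (by omega), eval_derivative_momentCubic_left] at this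
    rw [hN1] at this hlN
    rw [eval_derivative_momentCubic_right _ _ _ _ hlN, hM] at this
    simp only [zero_add] at this
    linarith

/-- **Theorem 4.5 (unique existence and fourth-order accuracy of periodic cubic spline
interpolation).**  Let `f ∈ C²([a,b]) ∩ C⁴([a,b]∖X_b)` be periodic in the sense that
`f(a) = f(b)`, `f'(a) = f'(b)`, `f''(a) = f''(b)`, with `|f⁽⁴⁾|` bounded away from the
breakpoints.  Then there is a unique periodic cubic spline `p ∈ 𝕊₃²(X_b)` interpolating
`f` at the breakpoints, and with `h` the maximum breakpoint spacing and
`K = max_{ξ∈[a,b]∖X_b} |f⁽⁴⁾(ξ)|` it satisfies, for all `l ∈ [a,b]` and `j = 0, 1, 2`,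
`|p⁽ʲ⁾(l) − f⁽ʲ⁾(l)| ≤ c_j h^{4−j} K` with `c₀ = 1/16`, `c₁ = c₂ = 1/2`. -/
theorem stmt5 (N : ℕ) (hN : 3 ≤ N) (l : ℕ → ℝ) (hl : ∀ i < N, l i < l (i + 1))
    (f f' f'' f3 f4 : ℝ → ℝ)
    (hf' : ∀ x ∈ Set.Icc (l 0) (l N), HasDerivWithinAt f (f' x) (Set.Icc (l 0) (l N)) x)
    (hf'' : ∀ x ∈ Set.Icc (l 0) (l N), HasDerivWithinAt f' (f'' x) (Set.Icc (l 0) (l N)) x)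
    (hf''c : ContinuousOn f'' (Set.Icc (l 0) (l N)))
    (hper0 : f (l 0) = f (l N)) (hper1 : f' (l 0) = f' (l N)) (hper2 : f'' (l 0) = f'' (l N))
    (hf3 : ∀ x ∈ {x : ℝ | ∃ i < N, x ∈ Set.Ioo (l i) (l (i + 1))}, HasDerivAt f'' (f3 x) x)
    (hf4 : ∀ x ∈ {x : ℝ | ∃ i < N, x ∈ Set.Ioo (l i) (l (i + 1))}, HasDerivAt f3 (f4 x) x)
    (hf4c : ContinuousOn f4 {x : ℝ | ∃ i < N, x ∈ Set.Ioo (l i) (l (i + 1))})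
    (hbdd : BddAbove ((fun ξ => |f4 ξ|) '' {x : ℝ | ∃ i < N, x ∈ Set.Ioo (l i) (l (i + 1))}))
    (h K : ℝ)
    (hh : h = (Finset.range N).sup' (Finset.nonempty_range_iff.mpr (by omega))
      (fun k => l (k + 1) - l k))
    (hK : K = sSup ((fun ξ => |f4 ξ|) ''
      {x : ℝ | ∃ i < N, x ∈ Set.Ioo (l i) (l (i + 1))})) :
    ∃ q : ℕ → Polynomial ℝ, IsPeriodicInterp N l f q ∧
      (∀ q' : ℕ → Polynomial ℝ, IsPeriodicInterp N l f q' → ∀ i < N, q' i = q i) ∧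
      (∀ i < N, ∀ x ∈ Set.Icc (l i) (l (i + 1)),
        |(q i).eval x - f x| ≤ 1 / 16 * h ^ 4 * K ∧
        |((q i).derivative).eval x - f' x| ≤ 1 / 2 * h ^ 3 * K ∧
        |((q i).derivative.derivative).eval x - f'' x| ≤ 1 / 2 * h ^ 2 * K) := by
  have hN0 : 0 < N := by omega
  have hN1 : N - 1 + 1 = N := by omega
  have hH : ∀ i < N, 0 < l (i + 1) - l i := fun i hi => sub_pos.2 (hl i hi)
  have hHh : ∀ i < N, l (i + 1) - l i ≤ h := fun i hi => by
    rw [hh]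
    exact Finset.le_sup' (fun k => l (k + 1) - l k) (Finset.mem_range.2 hi)
  have hmono : ∀ i j, i ≤ j → j ≤ N → l i ≤ l j := by
    intro i j hij
    induction j, hij using Nat.le_induction with
    | base => exact fun _ => le_rfl
    | succ j _ ih => exact fun hj => (ih (by omega)).trans (hl j hj).le
  have hsub : ∀ i < N, Set.Icc (l i) (l (i + 1)) ⊆ Set.Icc (l 0) (l N) := fun i hi =>
    Set.Icc_subset_Icc (hmono 0 i (by omega) hi.le) (hmono (i + 1) N hi le_rfl)
  have hf4K : ∀ i < N, ∀ x ∈ Set.Ioo (l i) (l (i + 1)), |f4 x| ≤ K := fun i hi x hx => by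
    rw [hK]
    exact le_csSup hbdd ⟨x, ⟨i, hi, hx⟩, rfl⟩
  have hK0 : 0 ≤ K := by
    obtain ⟨x, hx⟩ := Set.nonempty_Ioo.2 (hl 0 hN0)
    exact (abs_nonneg _).trans (hf4K 0 hN0 x hx)
  have hd1 : ∀ i < N, ∀ x ∈ Set.Icc (l i) (l (i + 1)),
      HasDerivWithinAt f (f' x) (Set.Icc (l i) (l (i + 1))) x := fun i hi x hx =>
    (hf' x (hsub i hi hx)).mono (hsub i hi)
  have hd2 : ∀ i < N, ∀ x ∈ Set.Icc (l i) (l (i + 1)),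
      HasDerivWithinAt f' (f'' x) (Set.Icc (l i) (l (i + 1))) x := fun i hi x hx =>
    (hf'' x (hsub i hi hx)).mono (hsub i hi)
  have hlin : ∀ i < N, ∀ x ∈ Set.Icc (l i) (l (i + 1)),
      |(f'' (l i) * (l (i + 1) - x) + f'' (l (i + 1)) * (x - l i)) / (l (i + 1) - l i) - f'' x| ≤
        K * (l (i + 1) - l i) ^ 2 / 8 := fun i hi x hx =>
    abs_linear_interp_sub_le (hl i hi) (hf''c.mono (hsub i hi)) (fun y hy => hf3 y ⟨i, hi, hy⟩)
      (fun y hy => hf4 y ⟨i, hi, hy⟩) (hf4K i hi) hK0 hx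
  have hdef := fun i hi => abs_derivative_momentCubic_sub_le (hl i hi) (hd1 i hi) (hd2 i hi)
    (hlin i hi)
  have hlast := hdef (N - 1) (by omega)
  have hHlast := hH (N - 1) (by omega)
  have hHhlast := hHh (N - 1) (by omega)
  obtain ⟨M, hM, hsys, hsys0⟩ := exists_cyclic_system hN0 hH
    (fun i => if i = 0 then 6 * ((f (l 1) - f (l 0)) / (l 1 - l 0) -
        (f (l N) - f (l (N - 1))) / (l N - l (N - 1)))
      else 6 * ((f (l (i + 1)) - f (l i)) / (l (i + 1) - l i) -
        (f (l i) - f (l (i - 1))) / (l i - l (i - 1))))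
  simp only [Nat.add_one_ne_zero, if_false, Nat.add_sub_cancel] at hsys
  simp only [if_true, hN1, zero_add] at hsys0
  rw [hN1] at hlast hHlast hHhlast
  have hcube : ∀ α, 0 < α → α ≤ h → 6 * (K * α ^ 2 / 8 * α / 2) ≤ α * (3 / 8 * h ^ 2 * K) := by
    intro α h0 h1
    have : α ^ 2 ≤ h ^ 2 := by gcongr
    nlinarith [mul_le_mul_of_nonneg_left this (mul_nonneg hK0 h0.le)]
  have herr : ∀ i ≤ N, |M i - f'' (l i)| ≤ 3 / 8 * h ^ 2 * K := by
    refine abs_le_of_cyclic_system (M := fun i => M i - f'' (l i)) hN0 hH ?_ (fun i hi => ?_) ?_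
    · simp only [hM, hper2]
    · have e1 := abs_le.1 (hdef i (by omega)).2
      have e2 := abs_le.1 (hdef (i + 1) hi).1
      have c1 := hcube _ (hH i (by omega)) (hHh i (by omega))
      have c2 := hcube _ (hH (i + 1) hi) (hHh (i + 1) hi)
      have := hsys i hi
      rw [abs_le]
      constructor <;> linarith
    · have e1 := abs_le.1 hlast.2
      have e2 := abs_le.1 (hdef 0 hN0).1
      have c1 := hcube _ hHlast hHhlast
      have c2 := hcube _ (hH 0 hN0) (hHh 0 hN0)
      simp only [hN1, zero_add] at e2 c2 ⊢
      rw [← hper1, ← hper2] at e1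
      rw [abs_le]
      constructor <;> linarith
  refine ⟨fun i => momentCubic (l i) (l (i + 1)) (f (l i)) (f (l (i + 1))) (M i) (M (i + 1)),
    isPeriodicInterp_momentCubic hN0 hl hper0 hM hsys hsys0, fun q' hq' => ?_,
    fun i hi x hx => ?_⟩
  · obtain ⟨M', hM', hpiece, hsys', hsys0'⟩ := hq'.exists_moments hN0 hl
    have hzero : ∀ i ≤ N, |M' i - M i| ≤ 0 := by
      refine abs_le_of_cyclic_system (M := fun i => M' i - M i) hN0 hH ?_ (fun i hi => ?_) ?_
      · simp only [hM, hM']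
      · rw [mul_zero, abs_nonpos_iff]
        linarith [hsys i hi, hsys' i hi]
      · rw [mul_zero, abs_nonpos_iff]
        simp only [hN1, zero_add]
        linarith
    have heq : ∀ i ≤ N, M' i = M i := fun i hi => sub_eq_zero.1 (abs_nonpos_iff.1 (hzero i hi))
    intro i hi
    rw [hpiece i hi, heq i hi.le, heq (i + 1) hi]
  · have hi0 := (hH i hi).le
    have hih := hHh i hi
    have hh0 : 0 ≤ h := hi0.trans hih
    have hB : ∀ x ∈ Set.Icc (l i) (l (i + 1)),
        |(M i * (l (i + 1) - x) + M (i + 1) * (x - l i)) / (l (i + 1) - l i) - f'' x| ≤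
          1 / 2 * h ^ 2 * K := fun x hx =>
      (abs_linear_interp_sub_le_of_endpoints (hl i hi) hx (herr i hi.le) (herr (i + 1) hi)
        (hlin i hi x hx)).trans (by
          have : K * (l (i + 1) - l i) ^ 2 ≤ K * h ^ 2 := by gcongr
          linarith)
    obtain ⟨b0, b1⟩ := abs_momentCubic_sub_le (hl i hi) (hd1 i hi) (hd2 i hi) hB hx
    refine ⟨b0.trans ?_, b1.trans ?_, ?_⟩
    · calc _ ≤ 1 / 2 * h ^ 2 * K * h ^ 2 / 8 := by gcongr
        _ = _ := by ring
    · calc _ ≤ 1 / 2 * h ^ 2 * K * h := by gcongr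
        _ = _ := by ring
    · rw [eval_derivative2_momentCubic _ _ _ _ (hl i hi)]
      exact hB x hx
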